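/- Let A_even = {2, 4, 6, 8, …} be the set of all positive even integers. For every nonempty set A of positive integers with 1 ∉ A such that A has local obstructions (i.e. there exists an integer q ≥ 2 for which the reduction of D_A modulo q is not all of ℤ/qℤ), one has δ_A ≤ δ_{A_even}. That is, among all alphabets not containing 1 that have local obstructions, A_even has the largest Hausdorff dimension. -/

import Mathlib

open scoped ENNReal

/-- The generator matrix `[[0,1],[1,a]]`. -/
def cfGen (a : ℕ) : Matrix (Fin 2) (Fin 2) ℤ := !![0, 1; 1, (a : ℤ)]

/-- The semigroup `G_A`: all nonempty finite products of the generators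
`[[0,1],[1,a]]` with `a ∈ A`. -/
def GSemigroup (A : Set ℕ) : Set (Matrix (Fin 2) (Fin 2) ℤ) :=
  { M | ∃ l : List ℕ, l ≠ [] ∧ (∀ a ∈ l, a ∈ A) ∧ M = (l.map cfGen).prod }

/-- The set `D_A` of bottom-right entries of matrices in `G_A`. -/
def Denoms (A : Set ℕ) : Set ℕ :=
  { d | ∃ M ∈ GSemigroup A, M 1 1 = (d : ℤ) }

/-- `A` has no local obstructions if for every `q ≥ 2` the reduction of `D_A`
mod `q` is all of `ℤ/qℤ`. -/
def HasNoLocalObstructions (A : Set ℕ) : Prop :=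
  ∀ q : ℕ, 2 ≤ q → ∀ r : ZMod q, ∃ d ∈ Denoms A, (d : ZMod q) = r

/-- The Gauss map `x ↦ {1/x}`. -/
noncomputable def gaussMap (x : ℝ) : ℝ := Int.fract x⁻¹

/-- The `(n+1)`-st partial quotient of `x`. -/
noncomputable def partialQuot (x : ℝ) (n : ℕ) : ℤ := ⌊(gaussMap^[n] x)⁻¹⌋

/-- The Cantor-like set `C_A` of irrationals in `(0,1)` all of whose partial
quotients lie in `A`. -/
def cfCantorSet (A : Set ℕ) : Set ℝ :=
  { x | Irrational x ∧ x ∈ Set.Ioo (0 : ℝ) 1 ∧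
      ∀ n : ℕ, ∃ a ∈ A, partialQuot x n = (a : ℤ) }

/-- The alphabet `A_even = {2,4,6,…}` of positive even integers. -/
def evenAlphabet : Set ℕ := {a : ℕ | 1 ≤ a ∧ a % 2 = 0}

/-! ### Two consecutive letters exclude local obstructions -/

lemma cfGen_prod_nonneg (l : List ℕ) (i j : Fin 2) : 0 ≤ (l.map cfGen).prod i j := by
  induction l generalizing i j with
  | nil => fin_cases i <;> fin_cases j <;> simp
  | cons a l ih =>
    rw [List.map_cons, List.prod_cons, Matrix.mul_apply, Fin.sum_univ_two]
    have h : ∀ i j, 0 ≤ cfGen a i j := by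
      intro i j
      fin_cases i <;> fin_cases j <;> simp [cfGen]
    exact add_nonneg (mul_nonneg (h _ _) (ih _ _)) (mul_nonneg (h _ _) (ih _ _))

/-- The reduction modulo `q` of the semigroup `G_A`, with the identity adjoined. -/
def reducedMonoid (A : Set ℕ) (q : ℕ) : Submonoid (Matrix (Fin 2) (Fin 2) (ZMod q)) :=
  Submonoid.closure ((fun a : ℕ => !![0, 1; 1, (a : ZMod q)]) '' A)

lemma exists_list_of_mem_reducedMonoid {A : Set ℕ} {q : ℕ}
    {M : Matrix (Fin 2) (Fin 2) (ZMod q)} (hM : M ∈ reducedMonoid A q) :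
    ∃ l : List ℕ, (∀ a ∈ l, a ∈ A) ∧
      (Int.castRingHom (ZMod q)).mapMatrix (l.map cfGen).prod = M := by
  induction hM using Submonoid.closure_induction with
  | mem x hx =>
    obtain ⟨a, ha, rfl⟩ := hx
    refine ⟨[a], by simpa using ha, ?_⟩
    ext i j
    fin_cases i <;> fin_cases j <;> simp [cfGen]
  | one => exact ⟨[], by simp, by simp⟩
  | mul x y _ _ hx hy =>
    obtain ⟨l, hl, rfl⟩ := hx
    obtain ⟨m, hm, rfl⟩ := hy
    refine ⟨l ++ m, ?_, by rw [List.map_append, List.prod_append, map_mul]⟩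
    intro a ha
    rcases List.mem_append.1 ha with h | h
    exacts [hl a h, hm a h]

lemma exists_mem_denoms_of_mem_reducedMonoid {A : Set ℕ} {q : ℕ} {a : ℕ} (ha : a ∈ A)
    {M : Matrix (Fin 2) (Fin 2) (ZMod q)} (hM : M ∈ reducedMonoid A q) :
    ∃ d ∈ Denoms A, (d : ZMod q) = (!![0, 1; 1, (a : ZMod q)] * M) 1 1 := by
  obtain ⟨l, hl, rfl⟩ := exists_list_of_mem_reducedMonoid hM
  have h0 := cfGen_prod_nonneg (a :: l) 1 1
  refine ⟨((((a :: l).map cfGen).prod) 1 1).toNat, ⟨_, ⟨a :: l, by simp, ?_, rfl⟩,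
    (Int.toNat_of_nonneg h0).symm⟩, ?_⟩
  · intro b hb
    rcases List.mem_cons.1 hb with rfl | h
    exacts [ha, hl b h]
  · rw [← Int.cast_natCast, Int.toNat_of_nonneg h0]
    simp [Matrix.mul_apply, Fin.sum_univ_two, cfGen]

lemma hasNoLocalObstructions_of_consecutive {A : Set ℕ} {a : ℕ} (ha : a ∈ A)
    (ha' : a + 1 ∈ A) : HasNoLocalObstructions A := by
  intro q hq r
  have : NeZero q := ⟨by omega⟩
  set g : ℕ → Matrix (Fin 2) (Fin 2) (ZMod q) := fun a => !![0, 1; 1, (a : ZMod q)] with hg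
  have hmem : ∀ b ∈ A, g b ∈ reducedMonoid A q :=
    fun b hb => Submonoid.subset_closure ⟨b, hb, rfl⟩
  have hinv : g a * !![-(a : ZMod q), 1; 1, 0] = 1 := by
    ext i j
    fin_cases i <;> fin_cases j <;> simp [hg, Matrix.mul_apply, Fin.sum_univ_two]
  have hinv' : !![-(a : ZMod q), 1; 1, 0] * g a = 1 := by
    ext i j
    fin_cases i <;> fin_cases j <;> simp [hg, Matrix.mul_apply, Fin.sum_univ_two]
  let u : (Matrix (Fin 2) (Fin 2) (ZMod q))ˣ := ⟨g a, _, hinv, hinv'⟩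
  have hI : !![-(a : ZMod q), 1; 1, 0] ∈ reducedMonoid A q := by
    have hu : u⁻¹ ∈ Submonoid.powers u := by
      rw [mem_powers_iff_mem_zpowers]
      exact inv_mem (Subgroup.mem_zpowers u)
    obtain ⟨n, hn⟩ := hu
    have : !![-(a : ZMod q), 1; 1, 0] = g a ^ n := by
      have := congrArg Units.val hn
      simpa [u] using this.symm
    rw [this]
    exact pow_mem (hmem a ha) n
  have hU : !![(1 : ZMod q), 1; 0, 1] ∈ reducedMonoid A q := by
    convert mul_mem hI (hmem _ ha') using 1
    ext i j
    fin_cases i <;> fin_cases j <;> simp [hg, Matrix.mul_apply, Fin.sum_univ_two]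
  have hpow : ∀ n : ℕ, !![(1 : ZMod q), 1; 0, 1] ^ n = !![1, (n : ZMod q); 0, 1] := by
    intro n
    induction n with
    | zero => simp [Matrix.one_fin_two]
    | succ n ih =>
      rw [pow_succ, ih]
      ext i j
      fin_cases i <;> fin_cases j <;> simp [Matrix.mul_apply, Fin.sum_univ_two, add_comm]
  obtain ⟨d, hd, hdr⟩ := exists_mem_denoms_of_mem_reducedMonoid ha'
    (mul_mem hI (pow_mem hU (r - 1).val))
  refine ⟨d, hd, ?_⟩
  rw [hdr, hpow]
  simp [Matrix.mul_apply, Fin.sum_univ_two]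
  ring

/-! ### Finite continued fractions -/

/-- Numerator and denominator of the continued fraction `[0; a₁, …, aₙ + x]`, as affine
functions of the tail `x`. -/
def cfPair (x : ℝ) : List ℕ → ℝ × ℝ
  | [] => (x, 1)
  | a :: l => ((cfPair x l).2, a * (cfPair x l).2 + (cfPair x l).1)

/-- The numerator of `[0; a₁, …, aₙ + x]`. -/
def cfNum (l : List ℕ) (x : ℝ) : ℝ := (cfPair x l).1

/-- The denominator of `[0; a₁, …, aₙ + x]`. -/
def cfDen (l : List ℕ) (x : ℝ) : ℝ := (cfPair x l).2

/-- The value of `[0; a₁, …, aₙ + x]`. -/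
noncomputable def cfMap (l : List ℕ) (x : ℝ) : ℝ := cfNum l x / cfDen l x

@[simp] lemma cfNum_nil (x : ℝ) : cfNum [] x = x := rfl

@[simp] lemma cfDen_nil (x : ℝ) : cfDen [] x = 1 := rfl

lemma cfNum_cons (a : ℕ) (l : List ℕ) (x : ℝ) : cfNum (a :: l) x = cfDen l x := rfl

lemma cfDen_cons (a : ℕ) (l : List ℕ) (x : ℝ) :
    cfDen (a :: l) x = a * cfDen l x + cfNum l x := rfl

@[simp] lemma cfMap_nil (x : ℝ) : cfMap [] x = x := by simp [cfMap]

lemma cfNum_nonneg_and_two_pow_le_cfDen {l : List ℕ} (hl : ∀ a ∈ l, 2 ≤ a) {x : ℝ}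
    (hx : 0 ≤ x) : 0 ≤ cfNum l x ∧ (2 : ℝ) ^ l.length ≤ cfDen l x := by
  induction l with
  | nil => simpa using hx
  | cons a l ih =>
    obtain ⟨h1, h2⟩ := ih fun b hb => hl b (List.mem_cons_of_mem _ hb)
    have ha : (2 : ℝ) ≤ a := by exact_mod_cast hl a List.mem_cons_self
    have h3 : (0 : ℝ) < 2 ^ l.length := by positivity
    rw [cfNum_cons, cfDen_cons, List.length_cons, pow_succ]
    exact ⟨by linarith, by nlinarith⟩

lemma cfNum_nonneg {l : List ℕ} (hl : ∀ a ∈ l, 2 ≤ a) {x : ℝ} (hx : 0 ≤ x) :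
    0 ≤ cfNum l x := (cfNum_nonneg_and_two_pow_le_cfDen hl hx).1

lemma two_pow_le_cfDen {l : List ℕ} (hl : ∀ a ∈ l, 2 ≤ a) {x : ℝ} (hx : 0 ≤ x) :
    (2 : ℝ) ^ l.length ≤ cfDen l x := (cfNum_nonneg_and_two_pow_le_cfDen hl hx).2

lemma cfDen_pos {l : List ℕ} (hl : ∀ a ∈ l, 2 ≤ a) {x : ℝ} (hx : 0 ≤ x) : 0 < cfDen l x :=
  lt_of_lt_of_le (by positivity) (two_pow_le_cfDen hl hx)

lemma cfMap_cons (a : ℕ) {l : List ℕ} (hl : ∀ a ∈ l, 2 ≤ a) {x : ℝ} (hx : 0 ≤ x) :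
    cfMap (a :: l) x = (a + cfMap l x)⁻¹ := by
  have h := (cfDen_pos hl hx).ne'
  rw [cfMap, cfMap, cfNum_cons, cfDen_cons, ← inv_div]
  congr 1
  field_simp

lemma cfMap_mem {l : List ℕ} (hl : ∀ a ∈ l, 2 ≤ a) {x : ℝ} (hx : x ∈ Set.Icc (0 : ℝ) (1 / 2)) :
    cfMap l x ∈ Set.Icc (0 : ℝ) (1 / 2) := by
  induction l with
  | nil => simpa using hx
  | cons a l ih =>
    have hl' : ∀ b ∈ l, 2 ≤ b := fun b hb => hl b (List.mem_cons_of_mem _ hb)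
    have ha : (2 : ℝ) ≤ a := by exact_mod_cast hl a List.mem_cons_self
    have h := ih hl'
    rw [cfMap_cons a hl' hx.1, one_div]
    exact ⟨inv_nonneg.2 (by linarith [h.1]), inv_anti₀ two_pos (by linarith [h.1])⟩

lemma cfNum_cfDen_append (u : List ℕ) {v : List ℕ} (hv : ∀ a ∈ v, 2 ≤ a) {x : ℝ} (hx : 0 ≤ x) :
    cfNum (u ++ v) x = cfNum u (cfMap v x) * cfDen v x ∧
      cfDen (u ++ v) x = cfDen u (cfMap v x) * cfDen v x := by
  induction u with
  | nil => simp [cfMap, (cfDen_pos hv hx).ne']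
  | cons a u ih =>
    rw [List.cons_append, cfNum_cons, cfDen_cons, cfNum_cons, cfDen_cons, ih.1, ih.2]
    exact ⟨rfl, by ring⟩

lemma cfDen_append (u : List ℕ) {v : List ℕ} (hv : ∀ a ∈ v, 2 ≤ a) {x : ℝ} (hx : 0 ≤ x) :
    cfDen (u ++ v) x = cfDen u (cfMap v x) * cfDen v x := (cfNum_cfDen_append u hv hx).2

lemma cfMap_append (u : List ℕ) {v : List ℕ} (hv : ∀ a ∈ v, 2 ≤ a) {x : ℝ} (hx : 0 ≤ x) :
    cfMap (u ++ v) x = cfMap u (cfMap v x) := by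
  rw [cfMap, (cfNum_cfDen_append u hv hx).1, (cfNum_cfDen_append u hv hx).2,
    mul_div_mul_right _ _ (cfDen_pos hv hx).ne']
  rfl

lemma exists_cfDen_eq_affine {l : List ℕ} (hl : ∀ a ∈ l, 2 ≤ a) :
    ∃ q q' : ℝ, 0 ≤ q' ∧ q' ≤ q ∧ ∀ x, 0 ≤ x → cfDen l x = q + q' * x := by
  induction l using List.reverseRecOn with
  | nil => exact ⟨1, 0, by simp⟩
  | append_singleton l a ih =>
    obtain ⟨q, q', h0, h1, h⟩ := ih fun b hb => hl b (by simp [hb])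
    have ha : ∀ b ∈ [a], 2 ≤ b := fun b hb => hl b (by simp at hb; simp [hb])
    have ha' : (2 : ℝ) ≤ a := by exact_mod_cast ha a (by simp)
    refine ⟨q * a + q', q, by linarith, by nlinarith, fun x hx => ?_⟩
    have hm : cfMap [a] x = (a + x)⁻¹ := by simpa using cfMap_cons a (l := []) (by simp) hx
    have hpos : 0 < a + x := by linarith
    rw [cfDen_append l ha hx, hm, h _ (inv_nonneg.2 hpos.le), cfDen_cons, cfDen_nil, cfNum_nil]
    field_simp
    ring

lemma cfDen_zero_le {l : List ℕ} (hl : ∀ a ∈ l, 2 ≤ a) {x : ℝ} (hx : 0 ≤ x) :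
    cfDen l 0 ≤ cfDen l x := by
  obtain ⟨q, q', h0, h1, h⟩ := exists_cfDen_eq_affine hl
  rw [h 0 le_rfl, h x hx]
  nlinarith

lemma cfDen_le_two_mul {l : List ℕ} (hl : ∀ a ∈ l, 2 ≤ a) {x : ℝ}
    (hx : x ∈ Set.Icc (0 : ℝ) (1 / 2)) : cfDen l x ≤ 2 * cfDen l 0 := by
  obtain ⟨q, q', h0, h1, h⟩ := exists_cfDen_eq_affine hl
  rw [h 0 le_rfl, h x hx.1]
  nlinarith [hx.1, hx.2]

lemma cfDen_append_zero_le {u v : List ℕ} (hu : ∀ a ∈ u, 2 ≤ a) (hv : ∀ a ∈ v, 2 ≤ a) :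
    cfDen (u ++ v) 0 ≤ 2 * cfDen u 0 * cfDen v 0 := by
  rw [cfDen_append u hv le_rfl]
  exact mul_le_mul_of_nonneg_right (cfDen_le_two_mul hu (cfMap_mem hv (by norm_num)))
    (cfDen_pos hv le_rfl).le

lemma abs_cfNum_mul_cfDen_sub (l : List ℕ) (x y : ℝ) :
    |cfNum l x * cfDen l y - cfNum l y * cfDen l x| = |x - y| := by
  induction l with
  | nil => simp
  | cons a l ih =>
    rw [← ih, ← abs_neg]
    simp only [cfNum_cons, cfDen_cons]
    congr 1
    ring

lemma abs_cfMap_sub {l : List ℕ} (hl : ∀ a ∈ l, 2 ≤ a) {x y : ℝ} (hx : 0 ≤ x) (hy : 0 ≤ y) :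
    |cfMap l x - cfMap l y| = |x - y| / (cfDen l x * cfDen l y) := by
  have h1 := cfDen_pos hl hx
  have h2 := cfDen_pos hl hy
  rw [cfMap, cfMap, div_sub_div _ _ h1.ne' h2.ne', abs_div, abs_of_pos (mul_pos h1 h2),
    ← abs_cfNum_mul_cfDen_sub l x y, mul_comm (cfDen l x) (cfNum l y)]

lemma abs_cfMap_sub_le {l : List ℕ} (hl : ∀ a ∈ l, 2 ≤ a) {x y : ℝ}
    (hx : x ∈ Set.Icc (0 : ℝ) (1 / 2)) (hy : y ∈ Set.Icc (0 : ℝ) (1 / 2)) :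
    |cfMap l x - cfMap l y| ≤ (cfDen l 0 ^ 2)⁻¹ := by
  have h0 := cfDen_pos hl le_rfl
  rw [abs_cfMap_sub hl hx.1 hy.1, ← one_div]
  refine div_le_div₀ zero_le_one ?_ (by positivity) ?_
  · rw [abs_le]
    constructor <;> linarith [hx.1, hx.2, hy.1, hy.2]
  · rw [sq]
    exact mul_le_mul (cfDen_zero_le hl hx.1) (cfDen_zero_le hl hy.1) h0.le
      (cfDen_pos hl hx.1).le

lemma le_abs_cfMap_sub {l : List ℕ} (hl : ∀ a ∈ l, 2 ≤ a) {x y : ℝ}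
    (hx : x ∈ Set.Icc (0 : ℝ) (1 / 2)) (hy : y ∈ Set.Icc (0 : ℝ) (1 / 2)) :
    |x - y| / 4 * (cfDen l 0 ^ 2)⁻¹ ≤ |cfMap l x - cfMap l y| := by
  have h0 := cfDen_pos hl le_rfl
  have h1 := cfDen_pos hl hx.1
  have h2 := cfDen_pos hl hy.1
  rw [abs_cfMap_sub hl hx.1 hy.1, ← div_eq_mul_inv, div_div]
  refine div_le_div_of_nonneg_left (abs_nonneg _) (by positivity) ?_
  nlinarith [mul_le_mul (cfDen_le_two_mul hl hx) (cfDen_le_two_mul hl hy) h2.le (by positivity)]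

lemma continuousOn_cfMap {l : List ℕ} (hl : ∀ a ∈ l, 2 ≤ a) :
    ContinuousOn (cfMap l) (Set.Icc 0 (1 / 2)) := by
  refine LipschitzOnWith.continuousOn (K := 1) (LipschitzOnWith.of_dist_le_mul ?_)
  intro x hx y hy
  have h1 : (1 : ℝ) ≤ cfDen l x := (one_le_pow₀ one_le_two).trans (two_pow_le_cfDen hl hx.1)
  have h2 : (1 : ℝ) ≤ cfDen l y := (one_le_pow₀ one_le_two).trans (two_pow_le_cfDen hl hy.1)
  rw [Real.dist_eq, Real.dist_eq, abs_cfMap_sub hl hx.1 hy.1, NNReal.coe_one, one_mul]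
  exact div_le_self (abs_nonneg _) (one_le_mul_of_one_le_of_one_le h1 h2)

lemma isCompact_cfMap_image {l : List ℕ} (hl : ∀ a ∈ l, 2 ≤ a) :
    IsCompact (cfMap l '' Set.Icc 0 (1 / 2)) :=
  isCompact_Icc.image_of_continuousOn (continuousOn_cfMap hl)

lemma cfNum_cfDen_map_le {f : ℕ → ℕ} (hf : ∀ a, f a ≤ a) (l : List ℕ) :
    (0 ≤ cfNum (l.map f) 0 ∧ 0 ≤ cfDen (l.map f) 0) ∧
      cfNum (l.map f) 0 ≤ cfNum l 0 ∧ cfDen (l.map f) 0 ≤ cfDen l 0 := by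
  induction l with
  | nil => simp
  | cons a l ih =>
    obtain ⟨⟨h1, h2⟩, h3, h4⟩ := ih
    have ha : (f a : ℝ) ≤ a := by exact_mod_cast hf a
    simp only [List.map_cons, cfNum_cons, cfDen_cons]
    exact ⟨⟨h2, by positivity⟩, h4, by gcongr⟩

lemma cfMap_injective_word {u v : List ℕ} (hu : ∀ a ∈ u, 2 ≤ a) (hv : ∀ a ∈ v, 2 ≤ a)
    (hlen : u.length = v.length) {x y : ℝ} (hx : x ∈ Set.Icc (0 : ℝ) (1 / 2))
    (hy : y ∈ Set.Icc (0 : ℝ) (1 / 2)) (h : cfMap u x = cfMap v y) : u = v := by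
  induction u generalizing v with
  | nil => exact (List.length_eq_zero_iff.1 hlen.symm).symm
  | cons a u ih =>
    cases v with
    | nil => simp at hlen
    | cons b v =>
      have hu' : ∀ b ∈ u, 2 ≤ b := fun b hb => hu b (List.mem_cons_of_mem _ hb)
      have hv' : ∀ b ∈ v, 2 ≤ b := fun b hb => hv b (List.mem_cons_of_mem _ hb)
      rw [cfMap_cons a hu' hx.1, cfMap_cons b hv' hy.1, inv_inj] at h
      have h1 := cfMap_mem hu' hx
      have h2 := cfMap_mem hv' hy
      have hab : a = b := by
        have e1 : (a : ℝ) < b + 1 := by linarith [h1.1, h2.2]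
        have e2 : (b : ℝ) < a + 1 := by linarith [h1.2, h2.1]
        norm_cast at e1 e2
        omega
      subst hab
      rw [ih hu' hv' (by simpa using hlen) (by linarith)]

/-! ### The Gauss map and the Cantor set -/

lemma irrational_of_forall_gaussMap_iterate_mem {x : ℝ}
    (h : ∀ n, gaussMap^[n] x ∈ Set.Ioo (0 : ℝ) 1) : Irrational x := by
  have key : ∀ q p : ℕ, ∀ x : ℝ, x = p / q → ¬ ∀ n, gaussMap^[n] x ∈ Set.Ioo (0 : ℝ) 1 := by
    intro q
    induction q using Nat.strong_induction_on with
    | _ q ih =>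
      intro p x hx hall
      have h0 : x ∈ Set.Ioo (0 : ℝ) 1 := hall 0
      have hq : 0 < q := by
        rcases Nat.eq_zero_or_pos q with rfl | hq
        · simp [hx] at h0
        · exact hq
      have hpq : p < q := by
        have := h0.2
        rw [hx, div_lt_one (by exact_mod_cast hq)] at this
        exact_mod_cast this
      refine ih p hpq (q % p) (gaussMap x) ?_ fun n => hall (n + 1)
      rw [gaussMap, hx, inv_div, Int.fract_div_natCast_eq_div_natCast_mod]
  rintro ⟨r, rfl⟩
  have hr : (0 : ℝ) < r := (h 0).1
  have hr' : 0 < r.num := Rat.num_pos.2 (by exact_mod_cast hr)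
  refine key r.den r.num.toNat r ?_ h
  have hnum : ((r.num.toNat : ℕ) : ℝ) = (r.num : ℝ) := by
    exact_mod_cast congrArg (Int.cast : ℤ → ℝ) (Int.toNat_of_nonneg hr'.le)
  rw [hnum]
  exact Rat.cast_def r

lemma exists_eq_inv_of_mem_cfCantorSet {A : Set ℕ} {x : ℝ} (hx : x ∈ cfCantorSet A) :
    ∃ a ∈ A, x = (a + gaussMap x)⁻¹ ∧ gaussMap x ∈ cfCantorSet A := by
  obtain ⟨hirr, hx01, hdig⟩ := hx
  obtain ⟨a, ha, hfl⟩ := hdig 0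
  have hfl' : ⌊x⁻¹⌋ = (a : ℤ) := hfl
  have hirr' : Irrational (gaussMap x) := by
    rw [gaussMap, Int.fract]
    exact (irrational_inv_iff.2 hirr).sub_intCast _
  refine ⟨a, ha, ?_, hirr', ⟨?_, Int.fract_lt_one _⟩, fun n => hdig (n + 1)⟩
  · rw [gaussMap, Int.fract, hfl', Int.cast_natCast, add_sub_cancel, inv_inv]
  · exact lt_of_le_of_ne (Int.fract_nonneg _) hirr'.ne_zero.symm

lemma mem_Icc_of_mem_cfCantorSet {A : Set ℕ} (hA : ∀ a ∈ A, 2 ≤ a) {x : ℝ}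
    (hx : x ∈ cfCantorSet A) : x ∈ Set.Icc (0 : ℝ) (1 / 2) := by
  obtain ⟨a, ha, hxa, h⟩ := exists_eq_inv_of_mem_cfCantorSet hx
  have ha' : (2 : ℝ) ≤ a := by exact_mod_cast hA a ha
  refine ⟨hx.2.1.1.le, ?_⟩
  rw [hxa, one_div]
  exact inv_anti₀ two_pos (by linarith [h.2.1.1])

lemma exists_word_of_mem_cfCantorSet {A : Set ℕ} (hA : ∀ a ∈ A, 2 ≤ a) (n : ℕ) {x : ℝ}
    (hx : x ∈ cfCantorSet A) :
    ∃ l : List ℕ, (l.length = n ∧ ∀ a ∈ l, a ∈ A) ∧ x ∈ cfMap l '' Set.Icc 0 (1 / 2) := by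
  induction n generalizing x with
  | zero => exact ⟨[], by simp, by simpa using mem_Icc_of_mem_cfCantorSet hA hx⟩
  | succ n ih =>
    obtain ⟨a, ha, hxa, h⟩ := exists_eq_inv_of_mem_cfCantorSet hx
    obtain ⟨l, ⟨hlen, hl⟩, t, ht, htx⟩ := ih h
    refine ⟨a :: l, ⟨by simp [hlen], ?_⟩, t, ht, ?_⟩
    · intro b hb
      rcases List.mem_cons.1 hb with rfl | hb
      exacts [ha, hl b hb]
    · rw [cfMap_cons a (fun b hb => hA b (hl b hb)) ht.1, htx, ← hxa]

/-- `x` lies in cylinders of arbitrarily long words over `A`. -/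
def HasLongWords (A : Set ℕ) (x : ℝ) : Prop :=
  ∀ m, ∃ u : List ℕ, m ≤ u.length ∧ (∀ a ∈ u, a ∈ A) ∧ x ∈ cfMap u '' Set.Icc 0 (1 / 2)

lemma HasLongWords.gaussMap {A : Set ℕ} (hA : ∀ a ∈ A, 2 ≤ a) {x : ℝ}
    (hx : HasLongWords A x) :
    HasLongWords A (gaussMap x) ∧ x ∈ Set.Ioo (0 : ℝ) 1 ∧ ∃ a ∈ A, ⌊x⁻¹⌋ = (a : ℤ) := by
  have key : ∀ m, ∃ u : List ℕ, m ≤ u.length ∧ (∀ a ∈ u, a ∈ A) ∧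
      (_root_.gaussMap x ∈ cfMap u '' Set.Icc 0 (1 / 2)) ∧ x ∈ Set.Ioo (0 : ℝ) 1 ∧
      ∃ a ∈ A, ⌊x⁻¹⌋ = (a : ℤ) := by
    intro m
    obtain ⟨u, hlen, hu, t, ht, htx⟩ := hx (m + 1)
    cases u with
    | nil => simp at hlen
    | cons a u =>
      have hu' : ∀ b ∈ u, b ∈ A := fun b hb => hu b (List.mem_cons_of_mem _ hb)
      have hu2 : ∀ b ∈ u, 2 ≤ b := fun b hb => hA b (hu' b hb)
      have ha : a ∈ A := hu a List.mem_cons_self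
      have ha2 : (2 : ℝ) ≤ a := by exact_mod_cast hA a ha
      have hm := cfMap_mem hu2 ht
      rw [cfMap_cons a hu2 ht.1] at htx
      have hinv : x⁻¹ = a + cfMap u t := by rw [← htx, inv_inv]
      have hfl : ⌊x⁻¹⌋ = (a : ℤ) := by
        rw [hinv, Int.floor_eq_iff]
        push_cast
        constructor <;> linarith [hm.1, hm.2]
      refine ⟨u, by simpa using hlen, hu', ⟨t, ht, ?_⟩, ⟨?_, ?_⟩, a, ha, hfl⟩
      · rw [_root_.gaussMap, Int.fract, hfl, hinv]
        push_cast
        ring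
      · rw [← htx]
        exact inv_pos.2 (by linarith [hm.1])
      · rw [← htx]
        exact inv_lt_one_of_one_lt₀ (by linarith [hm.1])
  refine ⟨fun m => ?_, ?_⟩
  · obtain ⟨u, h1, h2, h3, -⟩ := key m
    exact ⟨u, h1, h2, h3⟩
  · obtain ⟨-, -, -, -, h⟩ := key 0
    exact h

lemma HasLongWords.mem_cfCantorSet {A : Set ℕ} (hA : ∀ a ∈ A, 2 ≤ a) {x : ℝ}
    (hx : HasLongWords A x) : x ∈ cfCantorSet A := by
  have hiter : ∀ n, HasLongWords A (_root_.gaussMap^[n] x) := by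
    intro n
    induction n with
    | zero => exact hx
    | succ n ih =>
      rw [Function.iterate_succ_apply']
      exact (ih.gaussMap hA).1
  exact ⟨irrational_of_forall_gaussMap_iterate_mem fun n => ((hiter n).gaussMap hA).2.1,
    (hx.gaussMap hA).2.1, fun n => ((hiter n).gaussMap hA).2.2⟩

/-! ### Upper bound for the dimension -/

open Filter Topology MeasureTheory Measure in
lemma dimH_cfCantorSet_le {A : Set ℕ} (hA : ∀ a ∈ A, 2 ≤ a) {s : NNReal} {K : ℝ}
    (hK : ∀ (n : ℕ) (W : Finset (List ℕ)), (∀ w ∈ W, w.length = n ∧ ∀ a ∈ w, a ∈ A) →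
      ∑ w ∈ W, ((cfDen w 0 ^ 2)⁻¹) ^ (s : ℝ) ≤ K) :
    dimH (cfCantorSet A) ≤ s := by
  let ι : ℕ → Type := fun n => {l : List ℕ // l.length = n ∧ ∀ a ∈ l, a ∈ A}
  have h2 : ∀ n, ∀ l : ι n, ∀ a ∈ l.1, 2 ≤ a := fun n l a ha => hA a (l.2.2 a ha)
  have hdiam : ∀ n (l : ι n), Metric.ediam (cfMap l.1 '' Set.Icc 0 (1 / 2)) ≤
      ENNReal.ofReal ((cfDen l.1 0 ^ 2)⁻¹) := by
    intro n l
    refine Metric.ediam_le ?_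
    rintro _ ⟨x, hx, rfl⟩ _ ⟨y, hy, rfl⟩
    rw [edist_dist, Real.dist_eq]
    exact ENNReal.ofReal_le_ofReal (abs_cfMap_sub_le (h2 n l) hx hy)
  have hsum : ∀ n, ∑' l : ι n, Metric.ediam (cfMap l.1 '' Set.Icc 0 (1 / 2)) ^ (s : ℝ) ≤
      ENNReal.ofReal K := by
    intro n
    rw [ENNReal.tsum_eq_iSup_sum]
    refine iSup_le fun T => ?_
    calc ∑ l ∈ T, Metric.ediam (cfMap l.1 '' Set.Icc 0 (1 / 2)) ^ (s : ℝ)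
        ≤ ∑ l ∈ T, ENNReal.ofReal (((cfDen l.1 0 ^ 2)⁻¹) ^ (s : ℝ)) := by
          refine Finset.sum_le_sum fun l _ => ?_
          rw [← ENNReal.ofReal_rpow_of_nonneg (by positivity) s.coe_nonneg]
          exact ENNReal.rpow_le_rpow (hdiam n l) s.coe_nonneg
      _ = ENNReal.ofReal (∑ w ∈ T.map (Function.Embedding.subtype _),
            ((cfDen w 0 ^ 2)⁻¹) ^ (s : ℝ)) := by
          rw [Finset.sum_map, ENNReal.ofReal_sum_of_nonneg fun l _ => by positivity]
          rfl
      _ ≤ ENNReal.ofReal K := by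
          refine ENNReal.ofReal_le_ofReal (hK n _ ?_)
          intro w hw
          obtain ⟨l, -, rfl⟩ := Finset.mem_map.1 hw
          exact l.2
  refine dimH_le_of_hausdorffMeasure_ne_top (ne_top_of_le_ne_top (b := ENNReal.ofReal K)
    ENNReal.ofReal_ne_top
    ((hausdorffMeasure_le_liminf_tsum (s : ℝ) (cfCantorSet A) (l := atTop) (ι := ι)
      (fun n => ENNReal.ofReal ((1 / 2 : ℝ) ^ n)) ?_
      (fun n l => cfMap l.1 '' Set.Icc 0 (1 / 2)) ?_ ?_).trans ?_))
  · rw [← ENNReal.ofReal_zero]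
    exact ENNReal.tendsto_ofReal
      (tendsto_pow_atTop_nhds_zero_of_lt_one (by norm_num) (by norm_num))
  · refine Eventually.of_forall fun n l => (hdiam n l).trans (ENNReal.ofReal_le_ofReal ?_)
    have h1 := two_pow_le_cfDen (h2 n l) le_rfl
    rw [l.2.1] at h1
    have h3 : (1 : ℝ) ≤ 2 ^ n := one_le_pow₀ one_le_two
    rw [one_div, inv_pow]
    exact inv_anti₀ (by positivity) (by nlinarith)
  · refine Eventually.of_forall fun n x hx => ?_
    obtain ⟨l, hl, hxl⟩ := exists_word_of_mem_cfCantorSet hA n hx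
    exact Set.mem_iUnion.2 ⟨⟨l, hl⟩, hxl⟩
  · exact liminf_le_of_frequently_le' (Eventually.of_forall hsum).frequently

/-! ### Lower bound for the dimension -/

open MeasureTheory in
lemma exists_bernoulli_outerMeasure {ι : Type*} [Fintype ι] (p : ι → ℝ) (hp : ∀ i, 0 ≤ p i)
    (hp1 : ∑ i, p i = 1) :
    ∃ m : OuterMeasure (ℕ → ι), m Set.univ = 1 ∧ ∀ (k : ℕ) (ω : ℕ → ι),
      m {ω' | ∀ i < k, ω' i = ω i} = ENNReal.ofReal (∏ i ∈ Finset.range k, p (ω i)) := by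
  let _ : MeasurableSpace ι := ⊤
  have hsum : ∑ i, ENNReal.ofReal (p i) = 1 := by
    rw [← ENNReal.ofReal_sum_of_nonneg fun i _ => hp i, hp1, ENNReal.ofReal_one]
  let P : PMF ι := PMF.ofFintype (fun i => ENNReal.ofReal (p i)) hsum
  refine ⟨(Measure.infinitePi fun _ : ℕ => P.toMeasure).toOuterMeasure, ?_, fun k ω => ?_⟩
  · exact measure_univ (μ := Measure.infinitePi fun _ : ℕ => P.toMeasure)
  · have hset : {ω' : ℕ → ι | ∀ i < k, ω' i = ω i} =
        Set.pi (Finset.range k : Set ℕ) fun i => {ω i} := by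
      ext ω'
      simp
    rw [hset, Measure.coe_toOuterMeasure, Measure.infinitePi_pi _ fun i _ => MeasurableSpace.measurableSet_top,
      ENNReal.ofReal_prod_of_nonneg fun i _ => hp _]
    refine Finset.prod_congr rfl fun i _ => ?_
    rw [PMF.toMeasure_apply_singleton _ _ MeasurableSpace.measurableSet_top]
    rfl

/-- The concatenation of the first `k` blocks of a sequence of words. -/
def blockPrefix (ω : ℕ → List ℕ) : ℕ → List ℕ
  | 0 => []
  | k + 1 => blockPrefix ω k ++ ω k

lemma forall_mem_blockPrefix {ω : ℕ → List ℕ} {q : ℕ → Prop} (h : ∀ i, ∀ a ∈ ω i, q a)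
    (k : ℕ) : ∀ a ∈ blockPrefix ω k, q a := by
  induction k with
  | zero => simp [blockPrefix]
  | succ k ih =>
    intro a ha
    rcases List.mem_append.1 ha with ha | ha
    exacts [ih a ha, h k a ha]

lemma blockPrefix_congr {ω ω' : ℕ → List ℕ} {k : ℕ} (h : ∀ i < k, ω' i = ω i) :
    blockPrefix ω' k = blockPrefix ω k := by
  induction k with
  | zero => rfl
  | succ k ih => simp only [blockPrefix, ih fun i hi => h i (by omega), h k (by omega)]

lemma length_blockPrefix {ω : ℕ → List ℕ} {n : ℕ} (h : ∀ i, (ω i).length = n) (k : ℕ) :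
    (blockPrefix ω k).length = k * n := by
  induction k with
  | zero => simp [blockPrefix]
  | succ k ih => rw [blockPrefix, List.length_append, ih, h, Nat.succ_mul]

lemma exists_mem_cfMap_blockPrefix {ω : ℕ → List ℕ} (h : ∀ i, ∀ a ∈ ω i, 2 ≤ a) :
    ∃ x, ∀ k, x ∈ cfMap (blockPrefix ω k) '' Set.Icc 0 (1 / 2) := by
  have hp := forall_mem_blockPrefix h
  have hne := IsCompact.nonempty_iInter_of_sequence_nonempty_isCompact_isClosed
    (fun k => cfMap (blockPrefix ω k) '' Set.Icc 0 (1 / 2)) ?_ ?_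
    (isCompact_cfMap_image (hp 0)) fun k => (isCompact_cfMap_image (hp k)).isClosed
  · obtain ⟨x, hx⟩ := hne
    exact ⟨x, Set.mem_iInter.1 hx⟩
  · rintro k _ ⟨t, ht, rfl⟩
    exact ⟨_, cfMap_mem (h k) ht, (cfMap_append _ (h k) ht.1).symm⟩
  · exact fun k => Set.Nonempty.image _ ⟨0, by norm_num⟩

open Filter Topology in
lemma exists_separation {W : Finset (List ℕ)} {n : ℕ}
    (hW : ∀ w ∈ W, w.length = n ∧ ∀ a ∈ w, 2 ≤ a) :
    ∃ δ : ℝ, 0 < δ ∧ ∀ w ∈ W, ∀ w' ∈ W, w ≠ w' → ∀ t ∈ Set.Icc (0 : ℝ) (1 / 2),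
      ∀ t' ∈ Set.Icc (0 : ℝ) (1 / 2), δ ≤ |cfMap w t - cfMap w' t'| := by
  have key : ∀ᶠ δ : ℝ in 𝓝[>] 0, ∀ w ∈ W, ∀ w' ∈ W, w ≠ w' → ∀ t ∈ Set.Icc (0 : ℝ) (1 / 2),
      ∀ t' ∈ Set.Icc (0 : ℝ) (1 / 2), δ ≤ |cfMap w t - cfMap w' t'| := by
    rw [Finset.eventually_all]
    intro w hw
    rw [Finset.eventually_all]
    intro w' hw'
    by_cases hne : w = w'
    · exact Eventually.of_forall fun δ h => absurd hne h
    have hdisj : Disjoint (cfMap w '' Set.Icc 0 (1 / 2)) (cfMap w' '' Set.Icc 0 (1 / 2)) := by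
      rw [Set.disjoint_left]
      rintro _ ⟨t, ht, rfl⟩ ⟨t', ht', h⟩
      exact hne (cfMap_injective_word (hW w hw).2 (hW w' hw').2
        ((hW w hw).1.trans (hW w' hw').1.symm) ht ht' h.symm)
    obtain ⟨r, hr, h⟩ := Metric.exists_pos_forall_lt_edist
      (isCompact_cfMap_image (hW w hw).2) (isCompact_cfMap_image (hW w' hw').2).isClosed hdisj
    filter_upwards [Ioo_mem_nhdsGT (NNReal.coe_pos.2 hr)] with δ hδ _ t ht t' ht'
    have hlt := h _ ⟨t, ht, rfl⟩ _ ⟨t', ht', rfl⟩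
    rw [edist_nndist, ENNReal.coe_lt_coe, ← NNReal.coe_lt_coe, coe_nndist, Real.dist_eq] at hlt
    exact (hδ.2.trans hlt).le
  obtain ⟨δ, h, hδ⟩ := (key.and self_mem_nhdsWithin).exists
  exact ⟨δ, hδ, h⟩

lemma prod_le_cfDen_blockPrefix {ω : ℕ → List ℕ} (h : ∀ i, ∀ a ∈ ω i, 2 ≤ a) {s : ℝ}
    (hs : 0 ≤ s) (k : ℕ) :
    ∏ i ∈ Finset.range k, ((4 * cfDen (ω i) 0 ^ 2)⁻¹) ^ s ≤
      ((cfDen (blockPrefix ω k) 0 ^ 2)⁻¹) ^ s := by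
  induction k with
  | zero => simp [blockPrefix]
  | succ k ih =>
    have hk := forall_mem_blockPrefix h k
    have h1 := cfDen_pos hk le_rfl
    have h2 := cfDen_pos (h k) le_rfl
    have h3 := cfDen_pos (forall_mem_blockPrefix h (k + 1)) le_rfl
    rw [Finset.prod_range_succ]
    refine (mul_le_mul_of_nonneg_right ih (by positivity)).trans ?_
    rw [← Real.mul_rpow (by positivity) (by positivity), ← mul_inv]
    refine Real.rpow_le_rpow (by positivity) (inv_anti₀ (by positivity) ?_) hs
    calc cfDen (blockPrefix ω (k + 1)) 0 ^ 2
        ≤ (2 * cfDen (blockPrefix ω k) 0 * cfDen (ω k) 0) ^ 2 :=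
          pow_le_pow_left₀ h3.le (cfDen_append_zero_le hk (h k)) 2
      _ = _ := by ring

lemma separation_blockPrefix {ω ω' : ℕ → List ℕ} (h : ∀ i, ∀ a ∈ ω i, 2 ≤ a)
    (h' : ∀ i, ∀ a ∈ ω' i, 2 ≤ a) {k : ℕ} (hk : ∀ i < k, ω' i = ω i) {δ : ℝ}
    (hδ : ∀ t ∈ Set.Icc (0 : ℝ) (1 / 2), ∀ t' ∈ Set.Icc (0 : ℝ) (1 / 2),
      δ ≤ |cfMap (ω k) t - cfMap (ω' k) t'|) {x x' : ℝ}
    (hx : x ∈ cfMap (blockPrefix ω (k + 1)) '' Set.Icc 0 (1 / 2))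
    (hx' : x' ∈ cfMap (blockPrefix ω' (k + 1)) '' Set.Icc 0 (1 / 2)) :
    δ / 4 * (cfDen (blockPrefix ω k) 0 ^ 2)⁻¹ ≤ |x - x'| := by
  obtain ⟨t, ht, rfl⟩ := hx
  obtain ⟨t', ht', rfl⟩ := hx'
  have hp := forall_mem_blockPrefix h k
  have h0 := cfDen_pos hp le_rfl
  rw [blockPrefix, blockPrefix, cfMap_append _ (h k) ht.1, cfMap_append _ (h' k) ht'.1,
    blockPrefix_congr hk]
  refine le_trans ?_ (le_abs_cfMap_sub hp (cfMap_mem (h k) ht) (cfMap_mem (h' k) ht'))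
  gcongr
  exact hδ t ht t' ht'

open Filter Topology MeasureTheory Measure in
lemma le_dimH_cfCantorSet {A : Set ℕ} (hA : ∀ a ∈ A, 2 ≤ a) {s : NNReal} {n : ℕ}
    {W : Finset (List ℕ)} (hW : ∀ w ∈ W, w.length = n ∧ ∀ a ∈ w, a ∈ A)
    (hsum : (4 : ℝ) ^ (s : ℝ) < ∑ w ∈ W, ((cfDen w 0 ^ 2)⁻¹) ^ (s : ℝ)) :
    s ≤ dimH (cfCantorSet A) := by
  rcases eq_or_ne s 0 with rfl | hs_ne
  · exact zero_le
  have hs : (0 : ℝ) ≤ s := s.coe_nonneg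
  have hs0 : (0 : ℝ) < s := NNReal.coe_pos.2 (pos_of_ne_zero hs_ne)
  have hn : 0 < n := by
    rcases Nat.eq_zero_or_pos n with rfl | hn
    · have hsub : W ⊆ {[]} := fun w hw =>
        Finset.mem_singleton.2 (List.length_eq_zero_iff.1 (hW w hw).1)
      have h1 : ∑ w ∈ W, ((cfDen w 0 ^ 2)⁻¹) ^ (s : ℝ) ≤ 1 := by
        refine (Finset.sum_le_sum_of_subset_of_nonneg hsub fun w _ _ => by positivity).trans ?_
        simp
      exact absurd (hsum.trans_le h1) (Real.one_le_rpow (by norm_num) hs).not_gt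
    · exact hn
  have hW2 : ∀ w ∈ W, w.length = n ∧ ∀ a ∈ w, 2 ≤ a :=
    fun w hw => ⟨(hW w hw).1, fun a ha => hA a ((hW w hw).2 a ha)⟩
  obtain ⟨δ, hδ, hsep⟩ := exists_separation hW2
  set c : W → ℝ := fun w => ((4 * cfDen w.1 0 ^ 2)⁻¹) ^ (s : ℝ) with hc
  have hc0 : ∀ w, 0 ≤ c w := fun w => by positivity
  have hZ : 1 < ∑ w, c w := by
    have : ∑ w, c w = (4 ^ (s : ℝ))⁻¹ * ∑ w ∈ W, ((cfDen w 0 ^ 2)⁻¹) ^ (s : ℝ) := by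
      rw [← Finset.sum_coe_sort W, Finset.mul_sum]
      refine Finset.sum_congr rfl fun w _ => ?_
      rw [hc, ← Real.inv_rpow (by norm_num), ← Real.mul_rpow (by norm_num) (by positivity),
        ← mul_inv]
    rw [this, ← div_eq_inv_mul, one_lt_div (by positivity)]
    exact hsum
  have hZ0 : 0 < ∑ w, c w := one_pos.trans hZ
  obtain ⟨m, hm1, hm⟩ := exists_bernoulli_outerMeasure (fun w => c w / ∑ w, c w)
    (fun w => div_nonneg (hc0 w) hZ0.le) (by rw [← Finset.sum_div, div_self hZ0.ne'])
  have h2 : ∀ (ω : ℕ → W) (i : ℕ), ∀ a ∈ (ω i).1, 2 ≤ a := fun ω i => (hW2 _ (ω i).2).2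
  choose π hπ using fun ω : ℕ → W =>
    exists_mem_cfMap_blockPrefix (ω := fun i => (ω i).1) (h2 ω)
  have hcyl : ∀ (ω : ℕ → W) (k : ℕ), m {ω' | ∀ i < k, ω' i = ω i} ≤
      ENNReal.ofReal (((cfDen (blockPrefix (fun i => (ω i).1) k) 0 ^ 2)⁻¹) ^ (s : ℝ)) := by
    intro ω k
    rw [hm]
    refine ENNReal.ofReal_le_ofReal (le_trans ?_ (prod_le_cfDen_blockPrefix (h2 ω) hs k))
    exact Finset.prod_le_prod (fun i _ => div_nonneg (hc0 _) hZ0.le)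
      fun i _ => div_le_self (hc0 _) hZ.le
  set C : ENNReal := ENNReal.ofReal ((4 / δ) ^ (s : ℝ)) with hC
  have hCtop : C ≠ ⊤ := ENNReal.ofReal_ne_top
  have hC0 : C ≠ 0 := by
    rw [hC, Ne, ENNReal.ofReal_eq_zero, not_le]
    positivity
  have hpoint : ∀ ω, m {ω} = 0 := by
    intro ω
    have hlim : Tendsto (fun k : ℕ => ENNReal.ofReal (((1 / 2 : ℝ) ^ k) ^ (s : ℝ))) atTop
        (𝓝 0) := by
      have h := (tendsto_pow_atTop_nhds_zero_of_lt_one (r := (1 / 2 : ℝ)) (by norm_num)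
        (by norm_num)).rpow_const (p := (s : ℝ)) (Or.inr hs)
      rw [Real.zero_rpow hs0.ne'] at h
      simpa using ENNReal.tendsto_ofReal h
    refine le_antisymm (ge_of_tendsto' hlim fun k => ?_) bot_le
    refine (measure_mono (?_ : {ω} ⊆ {ω' | ∀ i < k, ω' i = ω i})).trans ((hcyl ω k).trans
      (ENNReal.ofReal_le_ofReal (Real.rpow_le_rpow (by positivity) ?_ hs)))
    · rintro _ rfl i -
      rfl
    · have h1 := two_pow_le_cfDen (forall_mem_blockPrefix (h2 ω) k) le_rfl
      rw [length_blockPrefix (fun i => (hW2 _ (ω i).2).1)] at h1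
      have h3 : (2 : ℝ) ^ k ≤ 2 ^ (k * n) :=
        pow_le_pow_right₀ one_le_two (Nat.le_mul_of_pos_right k hn)
      have h4 : (1 : ℝ) ≤ 2 ^ k := one_le_pow₀ one_le_two
      rw [one_div, inv_pow]
      exact inv_anti₀ (by positivity) (by nlinarith)
  have hbound : ∀ U : Set ℝ, m (π ⁻¹' U) ≤ C * Metric.ediam U ^ (s : ℝ) := by
    intro U
    rcases (π ⁻¹' U).subsingleton_or_nontrivial with hV | ⟨ω₀, hω₀, ω₁, hω₁, hne⟩
    · rcases hV.eq_empty_or_singleton with h | ⟨ω, h⟩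
      · simp [h]
      · simp [h, hpoint]
    have hex : ∃ k, ∃ ω ∈ π ⁻¹' U, ω k ≠ ω₀ k := by
      obtain ⟨k, hk⟩ := Function.ne_iff.1 hne
      exact ⟨k, ω₁, hω₁, hk.symm⟩
    classical
    obtain ⟨ω, hω, hk⟩ := Nat.find_spec hex
    have hmin : ∀ ω ∈ π ⁻¹' U, ∀ i < Nat.find hex, ω i = ω₀ i := by
      intro ω hω i hi
      by_contra hcon
      exact Nat.find_min hex hi ⟨ω, hω, hcon⟩
    set k := Nat.find hex
    set D := cfDen (blockPrefix (fun i => (ω₀ i).1) k) 0 with hD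
    have hD0 : 0 < D := cfDen_pos (forall_mem_blockPrefix (h2 ω₀) k) le_rfl
    have hdist : δ / 4 * (D ^ 2)⁻¹ ≤ |π ω₀ - π ω| :=
      separation_blockPrefix (h2 ω₀) (h2 ω)
        (fun i hi => congrArg Subtype.val (hmin ω hω i hi))
        (hsep _ (ω₀ k).2 _ (ω k).2 fun h => hk (Subtype.ext h.symm)) (hπ ω₀ _) (hπ ω _)
    have hdiam : ENNReal.ofReal (δ / 4 * (D ^ 2)⁻¹) ≤ Metric.ediam U := by
      refine le_trans ?_ (Metric.edist_le_ediam_of_mem hω₀ hω)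
      rw [edist_dist, Real.dist_eq]
      exact ENNReal.ofReal_le_ofReal hdist
    calc m (π ⁻¹' U) ≤ m {ω' | ∀ i < k, ω' i = ω₀ i} := measure_mono hmin
      _ ≤ ENNReal.ofReal (((D ^ 2)⁻¹) ^ (s : ℝ)) := hcyl ω₀ k
      _ = C * ENNReal.ofReal (δ / 4 * (D ^ 2)⁻¹) ^ (s : ℝ) := by
        rw [hC, ENNReal.ofReal_rpow_of_nonneg (by positivity) hs,
          ← ENNReal.ofReal_mul (by positivity), ← Real.mul_rpow (by positivity) (by positivity)]
        congr 2
        field_simp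
      _ ≤ C * Metric.ediam U ^ (s : ℝ) := by gcongr
  have hle : OuterMeasure.map π m ≤ C • OuterMeasure.mkMetric fun r => r ^ (s : ℝ) := by
    rw [← OuterMeasure.mkMetric_smul _ hCtop hC0]
    refine OuterMeasure.le_mkMetric _ _ 1 one_pos fun U _ => ?_
    rw [OuterMeasure.map_apply]
    exact hbound U
  have hpre : π ⁻¹' cfCantorSet A = Set.univ := by
    refine Set.eq_univ_of_forall fun ω => HasLongWords.mem_cfCantorSet hA fun k => ?_
    refine ⟨blockPrefix (fun i => (ω i).1) k, ?_,
      forall_mem_blockPrefix (fun i => (hW _ (ω i).2).2) k, hπ ω k⟩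
    rw [length_blockPrefix (fun i => (hW2 _ (ω i).2).1)]
    exact Nat.le_mul_of_pos_right k hn
  refine le_dimH_of_hausdorffMeasure_ne_zero fun h0 => ?_
  have h1 := hle (cfCantorSet A)
  rw [OuterMeasure.map_apply, hpre, hm1, _root_.smul_apply, OuterMeasure.coe_mkMetric] at h1
  change 1 ≤ C * μH[(s : ℝ)] (cfCantorSet A) at h1
  rw [h0, mul_zero] at h1
  exact absurd h1 (by simp)

/-! ### The comparison of alphabets -/

lemma injOn_list_map {α β : Type*} {f : α → β} {A : Set α} (hf : Set.InjOn f A) :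
    Set.InjOn (List.map f) {l | ∀ a ∈ l, a ∈ A} := by
  intro u hu v hv huv
  induction u generalizing v with
  | nil => exact (List.map_eq_nil_iff.1 huv.symm).symm
  | cons a u ih =>
    cases v with
    | nil => simp at huv
    | cons b v =>
      rw [List.map_cons, List.map_cons, List.cons.injEq] at huv
      rw [hf (hu a List.mem_cons_self) (hv b List.mem_cons_self) huv.1,
        ih (fun c hc => hu c (List.mem_cons_of_mem _ hc))
          (fun c hc => hv c (List.mem_cons_of_mem _ hc)) huv.2]

/-- Among all alphabets not containing 1 that have local obstructions, `A_even` has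
the largest Hausdorff dimension. -/
theorem evenAlphabet_maximal_with_local_obstructions (A : Set ℕ)
    (hne : A.Nonempty) (hpos : ∀ a ∈ A, 0 < a) (h1 : 1 ∉ A)
    (hobs : ¬ HasNoLocalObstructions A) :
    dimH (cfCantorSet A) ≤ dimH (cfCantorSet evenAlphabet) := by
  have hA2 : ∀ a ∈ A, 2 ≤ a := by
    intro a ha
    have h0 := hpos a ha
    have : a ≠ 1 := fun h => h1 (h ▸ ha)
    omega
  have hE2 : ∀ a ∈ evenAlphabet, 2 ≤ a := by
    rintro a ⟨ha, ha'⟩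
    omega
  let f : ℕ → ℕ := fun a => 2 * (a / 2)
  have hf : ∀ a, f a ≤ a := fun a => Nat.mul_div_le a 2
  have hfE : ∀ a ∈ A, f a ∈ evenAlphabet := by
    intro a ha
    have := hA2 a ha
    exact ⟨by simp only [f]; omega, by simp only [f]; omega⟩
  have hfinj : Set.InjOn f A := by
    intro a ha b hb hab
    by_contra hne
    have hcons : b = a + 1 ∨ a = b + 1 := by
      simp only [f] at hab
      omega
    rcases hcons with rfl | rfl
    · exact hobs (hasNoLocalObstructions_of_consecutive ha hb)
    · exact hobs (hasNoLocalObstructions_of_consecutive hb ha)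
  refine le_of_forall_gt_imp_ge_of_dense fun c hc => ?_
  obtain ⟨s, hs, hsc⟩ := ENNReal.lt_iff_exists_nnreal_btwn.1 hc
  refine le_trans (dimH_cfCantorSet_le hA2 (K := 4 ^ (s : ℝ)) fun n W hW => ?_) hsc.le
  have hinj : Set.InjOn (List.map f) (W : Set (List ℕ)) :=
    (injOn_list_map hfinj).mono fun w hw => (hW w hw).2
  calc ∑ w ∈ W, ((cfDen w 0 ^ 2)⁻¹) ^ (s : ℝ)
      ≤ ∑ w ∈ W, ((cfDen (w.map f) 0 ^ 2)⁻¹) ^ (s : ℝ) := by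
        refine Finset.sum_le_sum fun w hw => Real.rpow_le_rpow (by positivity) ?_ s.coe_nonneg
        have hpos' : 0 < cfDen (w.map f) 0 := by
          refine cfDen_pos (fun a ha => ?_) le_rfl
          obtain ⟨b, hb, rfl⟩ := List.mem_map.1 ha
          exact hE2 _ (hfE b ((hW w hw).2 b hb))
        exact inv_anti₀ (by positivity)
          (pow_le_pow_left₀ hpos'.le (cfNum_cfDen_map_le hf w).2.2 2)
    _ = ∑ w ∈ W.image (List.map f), ((cfDen w 0 ^ 2)⁻¹) ^ (s : ℝ) :=
      by rw [Finset.sum_image hinj]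
    _ ≤ 4 ^ (s : ℝ) := by
        by_contra! hlt
        refine (le_dimH_cfCantorSet hE2 (n := n) (fun w hw => ?_) hlt).not_gt hs
        obtain ⟨u, hu, rfl⟩ := Finset.mem_image.1 hw
        refine ⟨by simpa using (hW u hu).1, fun a ha => ?_⟩
        obtain ⟨b, hb, rfl⟩ := List.mem_map.1 ha
        exact hfE b ((hW u hu).2 b hb)
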